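/- Let μ ∈ ℝ with μ ∉ {−1,−2,−3,…} and let ν ≥ 1 be an odd integer. Then for every j ∈ ℕ₀ and every x > 0, Λ_{2,j}^{μ,ν}(x) = (2^μ·Γ(j+(μ+1)/2)/Γ(j+μ+1))·x^{−ν}·e^{−x}·M_j^{μ,ν}(2x), and M_j^{μ,ν} is a polynomial of degree j+(ν−1)/2. -/

import Mathlib

noncomputable section

open Set MeasureTheory Filter Topology

/-- The Euler operator `θ = x·d/dx` acting on real-valued functions on `ℝ`. -/
def eulerOp (u : ℝ → ℝ) : ℝ → ℝ := fun x => x * deriv u x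

/-- The operator `(θ + a)(θ + b) − x²` applied to `v`. -/
def quadOp (a b : ℝ) (v : ℝ → ℝ) : ℝ → ℝ := fun x =>
  eulerOp (fun y => eulerOp v y + b * v y) x
    + a * (eulerOp v x + b * v x) - x ^ 2 * v x

/-- The fourth-order operator `D_{μ,ν} = x⁻²((θ+μ+ν)(θ+μ) − x²)(θ(θ+ν) − x²)`. -/
def Dop (μ ν : ℝ) (u : ℝ → ℝ) : ℝ → ℝ := fun x =>
  quadOp (μ + ν) μ (quadOp 0 ν u) x / x ^ 2

/-- The normalized I-Bessel function `Ĩ_α(z) = Σ (z/2)^{2n}/(n!·Γ(n+α+1))`. -/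
def tildeI (α z : ℝ) : ℝ :=
  ∑' n : ℕ, (z / 2) ^ (2 * n) / ((n.factorial : ℝ) * Real.Gamma ((n : ℝ) + α + 1))

/-- The K-Bessel function `K_α(z) = ∫₀^∞ e^{−z·cosh s}·cosh(α·s) ds`. -/
def besselK (α z : ℝ) : ℝ :=
  ∫ s in Ioi (0 : ℝ), Real.exp (-z * Real.cosh s) * Real.cosh (α * s)

/-- The normalized K-Bessel function `K̃_α(z) = (z/2)^{−α}·K_α(z)`. -/
def tildeK (α z : ℝ) : ℝ := (z / 2) ^ (-α) * besselK α z

/-- The generating function `G₁^{μ,ν}(t,x)`. -/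
def genG₁ (μ ν t x : ℝ) : ℝ :=
  (1 - t) ^ (-(μ + ν + 2) / 2) * tildeI (μ / 2) (t * x / (1 - t)) * tildeI (ν / 2) (x / (1 - t))

/-- The generating function `G₂^{μ,ν}(t,x)`. -/
def genG₂ (μ ν t x : ℝ) : ℝ :=
  (1 - t) ^ (-(μ + ν + 2) / 2) * tildeI (μ / 2) (t * x / (1 - t)) * tildeK (ν / 2) (x / (1 - t))

/-- The generating function `G₃^{μ,ν}(t,x)`. -/
def genG₃ (μ ν t x : ℝ) : ℝ :=
  (1 - t) ^ (-(μ + ν + 2) / 2) * tildeK (μ / 2) (t * x / (1 - t)) * tildeI (ν / 2) (x / (1 - t))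

/-- The generating function `G₄^{μ,ν}(t,x)`. -/
def genG₄ (μ ν t x : ℝ) : ℝ :=
  (1 - t) ^ (-(μ + ν + 2) / 2) * tildeK (μ / 2) (t * x / (1 - t)) * tildeK (ν / 2) (x / (1 - t))

/-- `Λ₁ⱼ^{μ,ν}(x) = (1/j!)·(∂/∂t)^j|₀ G₁^{μ,ν}(t,x)`. -/
def Lambda₁ (μ ν : ℝ) (j : ℕ) (x : ℝ) : ℝ :=
  iteratedDeriv j (fun t => genG₁ μ ν t x) 0 / (j.factorial : ℝ)

/-- `Λ₂ⱼ^{μ,ν}(x) = (1/j!)·(∂/∂t)^j|₀ G₂^{μ,ν}(t,x)`. -/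
def Lambda₂ (μ ν : ℝ) (j : ℕ) (x : ℝ) : ℝ :=
  iteratedDeriv j (fun t => genG₂ μ ν t x) 0 / (j.factorial : ℝ)

/-- `Λ₁ⱼ` for integer `j`, vanishing for `j < 0`. -/
def Lambda₁Z (μ ν : ℝ) (j : ℤ) (x : ℝ) : ℝ :=
  if 0 ≤ j then Lambda₁ μ ν j.toNat x else 0

/-- `Λ₂ⱼ` for integer `j`, vanishing for `j < 0`. -/
def Lambda₂Z (μ ν : ℝ) (j : ℤ) (x : ℝ) : ℝ :=
  if 0 ≤ j then Lambda₂ μ ν j.toNat x else 0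

/-- For `μ = m` a positive odd integer, `Λ₃ⱼ^{μ,ν}(x) = (1/(j+μ)!)·(∂/∂t)^{j+μ}|₀ [tᵐ·G₃]`,
the derivative at `0` being the limit from the right of the `(j+μ)`-th derivative of the
real-analytic function `t ↦ tᵐ·G₃^{m,ν}(t,x)` on `(0,1)`; it vanishes for `j < −μ`. -/
def Lambda₃ (m : ℕ) (ν : ℝ) (j : ℤ) (x : ℝ) : ℝ :=
  if -(m : ℤ) ≤ j then
    limUnder (𝓝[>] (0 : ℝ))
        (fun t => iteratedDeriv (j + (m : ℤ)).toNat (fun s => s ^ m * genG₃ (m : ℝ) ν s x) t) /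
      (((j + (m : ℤ)).toNat.factorial : ℝ))
  else 0

/-- For `μ = m` a positive odd integer, `Λ₄ⱼ^{μ,ν}(x) = (1/(j+μ)!)·(∂/∂t)^{j+μ}|₀ [tᵐ·G₄]`,
vanishing for `j < −μ`. -/
def Lambda₄ (m : ℕ) (ν : ℝ) (j : ℤ) (x : ℝ) : ℝ :=
  if -(m : ℤ) ≤ j then
    limUnder (𝓝[>] (0 : ℝ))
        (fun t => iteratedDeriv (j + (m : ℤ)).toNat (fun s => s ^ m * genG₄ (m : ℝ) ν s x) t) /
      (((j + (m : ℤ)).toNat.factorial : ℝ))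
  else 0

/-- The Laguerre polynomial
`Lₙ^α(z) = ((α+1)ₙ/n!)·Σ_{k=0}^n binom(n,k)·((−1)^k/(α+1)ₖ)·z^k`. -/
def laguerreL (n : ℕ) (α : ℝ) (z : ℝ) : ℝ :=
  (ascPochhammer ℝ n).eval (α + 1) / (n.factorial : ℝ) *
    ∑ k ∈ Finset.range (n + 1),
      (n.choose k : ℝ) * ((-1) ^ k / (ascPochhammer ℝ k).eval (α + 1)) * z ^ k

/-- The polynomial `M_j^{μ,ν}` (for `ν ≥ 1` an odd integer), the inner sum being empty when
`(ν−1)/2 − k < 0`. -/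
def polyM (μ : ℝ) (ν : ℕ) (j : ℕ) (x : ℝ) : ℝ :=
  Real.Gamma ((j : ℝ) + μ + 1) / Real.Gamma ((j : ℝ) + (μ + 1) / 2) *
    ∑ k ∈ Finset.range (j + 1), ∑ i ∈ Finset.range ((ν - 1) / 2 + 1 - k),
      (-1) ^ k *
        (Real.Gamma (((j - k : ℕ) : ℝ) + (μ + 1) / 2) * ((ν - i - 1).factorial : ℝ)) /
        ((k.factorial : ℝ) * Real.Gamma (((j - k : ℕ) : ℝ) + μ + 1) *
          (((ν - 1) / 2 - i - k).factorial : ℝ) * (i.factorial : ℝ)) *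
        laguerreL (j - k) μ x * x ^ i

/-- The Maclaurin series of a real function, as a formal power series. -/
def maclaurin (f : ℝ → ℝ) : PowerSeries ℝ :=
  PowerSeries.mk fun n => iteratedDeriv n f 0 / (n.factorial : ℝ)

lemma coeff_maclaurin (f : ℝ → ℝ) (n : ℕ) :
    PowerSeries.coeff n (maclaurin f) = iteratedDeriv n f 0 / (n.factorial : ℝ) :=
  PowerSeries.coeff_mk _ _

lemma maclaurin_congr {f g : ℝ → ℝ} (h : f =ᶠ[𝓝 0] g) : maclaurin f = maclaurin g := by
  ext n
  rw [coeff_maclaurin, coeff_maclaurin, h.iteratedDeriv_eq n]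

lemma maclaurin_const_mul (c : ℝ) (f : ℝ → ℝ) :
    maclaurin (fun t => c * f t) = PowerSeries.C c * maclaurin f := by
  ext n
  rw [PowerSeries.coeff_C_mul, coeff_maclaurin, coeff_maclaurin, iteratedDeriv_const_mul_field,
    mul_div_assoc]

lemma maclaurin_sum {ι : Type*} (I : Finset ι) {f : ι → ℝ → ℝ}
    (hf : ∀ i ∈ I, AnalyticAt ℝ (f i) 0) :
    maclaurin (fun t => ∑ i ∈ I, f i t) = ∑ i ∈ I, maclaurin (f i) := by
  ext n
  rw [map_sum, coeff_maclaurin, iteratedDeriv_fun_sum fun i hi => (hf i hi).contDiffAt,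
    Finset.sum_div]
  exact Finset.sum_congr rfl fun i _ => (coeff_maclaurin _ _).symm

lemma maclaurin_add {f g : ℝ → ℝ} (hf : AnalyticAt ℝ f 0) (hg : AnalyticAt ℝ g 0) :
    maclaurin (fun t => f t + g t) = maclaurin f + maclaurin g := by
  ext n
  rw [map_add, coeff_maclaurin, coeff_maclaurin, coeff_maclaurin, ← add_div,
    ← iteratedDeriv_add hf.contDiffAt hg.contDiffAt]
  rfl

lemma maclaurin_mul {f g : ℝ → ℝ} (hf : AnalyticAt ℝ f 0) (hg : AnalyticAt ℝ g 0) :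
    maclaurin (fun t => f t * g t) = maclaurin f * maclaurin g := by
  ext n
  rw [PowerSeries.coeff_mul, coeff_maclaurin,
    iteratedDeriv_fun_mul hf.contDiffAt hg.contDiffAt, Finset.sum_div,
    Finset.Nat.sum_antidiagonal_eq_sum_range_succ
      (fun i k => PowerSeries.coeff i (maclaurin f) * PowerSeries.coeff k (maclaurin g))]
  refine Finset.sum_congr rfl fun i hi => ?_
  have hin : i ≤ n := Nat.lt_succ_iff.mp (Finset.mem_range.mp hi)
  rw [coeff_maclaurin, coeff_maclaurin, Nat.cast_choose ℝ hin]
  have h1 : (n.factorial : ℝ) ≠ 0 := by positivity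
  field_simp

lemma maclaurin_pow (k : ℕ) : maclaurin (fun t => t ^ k) = PowerSeries.X ^ k := by
  ext n
  rw [coeff_maclaurin, iteratedDeriv_fun_pow_zero, PowerSeries.coeff_X_pow]
  split_ifs with h
  · subst h
    exact div_self (by positivity)
  · simp

/-- A function given near `0` by a convergent power series is analytic at `0`, with that series
as its Maclaurin series. -/
lemma analyticAt_and_maclaurin_of_hasSum {f : ℝ → ℝ} {c : ℕ → ℝ}
    (h : ∀ z, HasSum (fun n => c n * z ^ n) (f z)) :
    AnalyticAt ℝ f 0 ∧ maclaurin f = PowerSeries.mk c := by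
  have hp : HasFPowerSeriesAt f (FormalMultilinearSeries.ofScalars ℝ c) 0 := by
    rw [hasFPowerSeriesAt_iff]
    refine Eventually.of_forall fun z => ?_
    simpa [FormalMultilinearSeries.coeff_ofScalars, mul_comm] using h z
  refine ⟨hp.analyticAt, ?_⟩
  ext n
  have h2 := hp.eq_formalMultilinearSeries hp.analyticAt.hasFPowerSeriesAt
  have h3 := congrArg (fun p => FormalMultilinearSeries.coeff p n) h2
  simp only [FormalMultilinearSeries.coeff_ofScalars] at h3
  rw [coeff_maclaurin, PowerSeries.coeff_mk, h3]

lemma analyticAt_one_sub_rpow (s : ℝ) : AnalyticAt ℝ (fun t : ℝ => (1 - t) ^ s) 0 := by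
  have h1 : AnalyticAt ℝ (fun t : ℝ => 1 - t) 0 := by fun_prop
  have h2 : AnalyticAt ℝ (fun t : ℝ => Real.exp (Real.log (1 - t) * s)) 0 := by
    refine AnalyticAt.rexp' ?_
    exact (h1.log (by norm_num)).mul analyticAt_const
  refine h2.congr ?_
  filter_upwards [eventually_lt_nhds (zero_lt_one' ℝ)] with t ht
  rw [Real.rpow_def_of_pos (by linarith)]

lemma ascPochhammer_eval_succ_left (n : ℕ) (s : ℝ) :
    (ascPochhammer ℝ (n + 1)).eval s = s * (ascPochhammer ℝ n).eval (s + 1) := by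
  rw [ascPochhammer_succ_left]
  simp

lemma ascPochhammer_eval_add (n m : ℕ) (s : ℝ) :
    (ascPochhammer ℝ (n + m)).eval s
      = (ascPochhammer ℝ n).eval s * (ascPochhammer ℝ m).eval (s + n) := by
  rw [← ascPochhammer_mul]
  simp

/-- The binomial series. -/
lemma coeff_maclaurin_one_sub_rpow_neg (n : ℕ) (s : ℝ) :
    PowerSeries.coeff n (maclaurin fun t => (1 - t) ^ (-s))
      = (ascPochhammer ℝ n).eval s / (n.factorial : ℝ) := by
  rw [coeff_maclaurin]
  congr 1
  induction n generalizing s with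
  | zero => simp
  | succ n ih =>
    rw [iteratedDeriv_succ', ascPochhammer_eval_succ_left, ← ih, ← iteratedDeriv_const_mul_field]
    refine Filter.EventuallyEq.iteratedDeriv_eq n ?_
    filter_upwards [eventually_lt_nhds (zero_lt_one' ℝ)] with t ht
    have h1 : HasDerivAt (fun t : ℝ => 1 - t) (-1) t := by
      simpa using (hasDerivAt_id t).const_sub 1
    have h2 := h1.rpow_const (p := -s) (Or.inl (by linarith))
    rw [h2.deriv, show -(s + 1) = -s - 1 by ring]
    ring

/-- The Maclaurin coefficients of `(1 - t)^{-s}·Φ(x·t/(1 - t))`. -/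
lemma coeff_maclaurin_one_sub_rpow_mul_comp {Φ : ℝ → ℝ} (hΦ : AnalyticAt ℝ Φ 0) (s x : ℝ)
    (n : ℕ) :
    PowerSeries.coeff n (maclaurin fun t => (1 - t) ^ (-s) * Φ (t * x / (1 - t)))
      = ∑ k ∈ Finset.range (n + 1), PowerSeries.coeff k (maclaurin Φ) * x ^ k *
          ((ascPochhammer ℝ (n - k)).eval (s + k) / ((n - k).factorial : ℝ)) := by
  obtain ⟨F, hF, hΦF⟩ := hΦ.exists_eq_sum_add_pow_mul (n + 1)
  have hw : AnalyticAt ℝ (fun t : ℝ => t * x / (1 - t)) 0 := by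
    refine AnalyticAt.div (by fun_prop) (by fun_prop) (by norm_num)
  have hFw : AnalyticAt ℝ (fun t : ℝ => F (t * x / (1 - t))) 0 :=
    AnalyticAt.fun_comp (g := F) (by simpa using hF) hw
  have hterm : ∀ k : ℕ, AnalyticAt ℝ (fun t : ℝ => t ^ k * (1 - t) ^ (-(s + k))) 0 := fun k =>
    (by fun_prop : AnalyticAt ℝ (fun t : ℝ => t ^ k) 0).mul (analyticAt_one_sub_rpow _)
  have hrem : AnalyticAt ℝ
      (fun t : ℝ => (x ^ (n + 1) * (1 - t) ^ (-(s + (n + 1 : ℕ)))) * F (t * x / (1 - t))) 0 :=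
    (analyticAt_const.mul (analyticAt_one_sub_rpow _)).mul hFw
  have key : (fun t => (1 - t) ^ (-s) * Φ (t * x / (1 - t))) =ᶠ[𝓝 0] fun t =>
      (∑ k ∈ Finset.range (n + 1), (PowerSeries.coeff k (maclaurin Φ) * x ^ k) *
        (t ^ k * (1 - t) ^ (-(s + k)))) +
      t ^ (n + 1) * ((x ^ (n + 1) * (1 - t) ^ (-(s + (n + 1 : ℕ)))) * F (t * x / (1 - t))) := by
    filter_upwards [eventually_lt_nhds (zero_lt_one' ℝ)] with t ht
    have ht' : 0 < 1 - t := by linarith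
    have hr : ∀ k : ℕ, (1 - t) ^ (-(s + k)) = (1 - t) ^ (-s) / (1 - t) ^ k := fun k => by
      rw [neg_add, ← sub_eq_add_neg, Real.rpow_sub ht', Real.rpow_natCast]
    rw [hΦF, mul_add, Finset.mul_sum]
    congr 1
    · refine Finset.sum_congr rfl fun k _ => ?_
      rw [hr, coeff_maclaurin, smul_eq_mul, div_pow, mul_pow]
      ring
    · rw [hr, smul_eq_mul, div_pow, mul_pow]
      ring
  rw [maclaurin_congr key, maclaurin_add, maclaurin_sum, maclaurin_mul, maclaurin_pow, map_add,
    map_sum, PowerSeries.coeff_X_pow_mul', if_neg (by omega), add_zero]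
  · refine Finset.sum_congr rfl fun k hk => ?_
    have hkn : k ≤ n := Nat.lt_succ_iff.mp (Finset.mem_range.mp hk)
    rw [maclaurin_const_mul, PowerSeries.coeff_C_mul, maclaurin_mul (by fun_prop)
      (analyticAt_one_sub_rpow _), maclaurin_pow, PowerSeries.coeff_X_pow_mul', if_pos hkn,
      coeff_maclaurin_one_sub_rpow_neg]
  · fun_prop
  · exact hrem
  · exact fun k _ => analyticAt_const.mul (hterm k)
  · exact Finset.analyticAt_fun_sum _ fun k _ => analyticAt_const.mul (hterm k)
  · exact (by fun_prop : AnalyticAt ℝ (fun t : ℝ => t ^ (n + 1)) 0).mul hrem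

lemma summable_tildeI (α u : ℝ) :
    Summable fun n : ℕ => u ^ n / ((n.factorial : ℝ) * Real.Gamma ((n : ℝ) + α + 1)) := by
  refine Summable.of_norm_bounded_eventually_nat (Real.summable_pow_div_factorial |u|) ?_
  filter_upwards [eventually_ge_atTop ⌈1 - α⌉₊] with n hn
  have h1 : 1 - α ≤ n := Nat.ceil_le.mp hn
  have h2 : 1 ≤ Real.Gamma ((n : ℝ) + α + 1) := by
    have h := Real.Gamma_strictMonoOn_Ici.monotoneOn (mem_Ici.mpr le_rfl)
      (mem_Ici.mpr (by linarith : 2 ≤ (n : ℝ) + α + 1)) (by linarith)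
    rwa [Real.Gamma_two] at h
  have h3 : (0 : ℝ) < n.factorial := by positivity
  rw [Real.norm_eq_abs, abs_div, abs_pow, abs_of_pos (mul_pos h3 (by linarith))]
  gcongr
  nlinarith

/-- The Maclaurin coefficients of the normalized I-Bessel function. -/
def tildeICoeff (α : ℝ) (n : ℕ) : ℝ :=
  if Even n then (1 / 2) ^ n / (((n / 2).factorial : ℝ) * Real.Gamma (((n / 2 : ℕ) : ℝ) + α + 1))
  else 0

lemma hasSum_tildeI (α z : ℝ) : HasSum (fun n => tildeICoeff α n * z ^ n) (tildeI α z) := by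
  have hinj : Function.Injective fun m : ℕ => 2 * m := fun a b h => by simpa using h
  rw [← hinj.hasSum_iff]
  · have h := summable_tildeI α ((z / 2) ^ 2)
    simp_rw [← pow_mul] at h
    refine h.hasSum.congr_fun fun m => ?_
    simp [tildeICoeff, div_pow]
    ring
  · intro n hn
    rw [tildeICoeff, if_neg, zero_mul]
    rintro ⟨m, rfl⟩
    exact hn ⟨m, two_mul m⟩

lemma tildeICoeff_recurrence {α : ℝ} (hα : ∀ m : ℕ, α ≠ -((m : ℝ) + 1)) (n : ℕ) :
    ((n : ℝ) + 2) * ((n : ℝ) + 2 + 2 * α) * tildeICoeff α (n + 2) = tildeICoeff α n := by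
  by_cases h : Even n
  · have h' : Even (n + 2) := by simpa [Nat.even_add] using h
    rw [tildeICoeff, tildeICoeff, if_pos h, if_pos h']
    obtain ⟨m, rfl⟩ := h
    have e1 : (m + m + 2) / 2 = m + 1 := by omega
    have e2 : (m + m) / 2 = m := by omega
    have h1 : (m : ℝ) + α + 1 ≠ 0 := fun h0 => hα m (by linarith)
    rw [e1, e2, Nat.factorial_succ]
    push_cast
    rw [show (m : ℝ) + 1 + α + 1 = (m + α + 1) + 1 by ring, Real.Gamma_add_one h1]
    have h2 : (m.factorial : ℝ) ≠ 0 := by positivity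
    have h3 : (m : ℝ) + 1 ≠ 0 := by positivity
    have h4 : Real.Gamma (m + α + 1) ≠ 0 := by
      refine Real.Gamma_ne_zero fun k hk => hα (m + k) ?_
      push_cast
      linarith
    field_simp
    ring
  · have h' : ¬ Even (n + 2) := by simpa [Nat.even_add] using h
    simp [tildeICoeff, h, h']

lemma tildeICoeff_one (α : ℝ) : tildeICoeff α 1 = 0 := by
  simp [tildeICoeff]

lemma analyticAt_tildeI (α : ℝ) : AnalyticAt ℝ (tildeI α) 0 :=
  (analyticAt_and_maclaurin_of_hasSum (hasSum_tildeI α)).1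

lemma maclaurin_tildeI (α : ℝ) : maclaurin (tildeI α) = PowerSeries.mk (tildeICoeff α) :=
  (analyticAt_and_maclaurin_of_hasSum (hasSum_tildeI α)).2

lemma maclaurin_exp_neg :
    maclaurin (fun t => Real.exp (-t)) = PowerSeries.mk fun n => (-1) ^ n / (n.factorial : ℝ) := by
  ext n
  rw [coeff_maclaurin, PowerSeries.coeff_mk, iteratedDeriv_comp_neg]
  simp [iteratedDeriv_eq_iterate]

/-- The modified Bessel equation for the normalized I-Bessel function, as an identity of
formal power series. -/
lemma maclaurin_tildeI_ode {α : ℝ} (hα : ∀ m : ℕ, α ≠ -((m : ℝ) + 1)) :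
    PowerSeries.X * (PowerSeries.derivative ℝ (PowerSeries.derivative ℝ (maclaurin (tildeI α))))
        + PowerSeries.C (2 * α + 1) * PowerSeries.derivative ℝ (maclaurin (tildeI α))
      = PowerSeries.X * maclaurin (tildeI α) := by
  ext n
  rw [maclaurin_tildeI]
  rcases n with _ | n
  · rw [map_add, PowerSeries.coeff_zero_X_mul, PowerSeries.coeff_zero_X_mul,
      PowerSeries.coeff_C_mul, PowerSeries.coeff_derivative, PowerSeries.coeff_mk,
      tildeICoeff_one]
    ring
  · rw [map_add, PowerSeries.coeff_succ_X_mul, PowerSeries.coeff_succ_X_mul,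
      PowerSeries.coeff_C_mul]
    simp only [PowerSeries.coeff_derivative, PowerSeries.coeff_mk]
    rw [← tildeICoeff_recurrence hα n]
    push_cast
    ring

/-- Kummer's second formula: the Maclaurin coefficients of `e^{-w}·Ĩ_α(w)`. -/
lemma coeff_maclaurin_exp_neg_mul_tildeI {α : ℝ} (hα : ∀ m : ℕ, α ≠ -((m : ℝ) + 1))
    (hα' : ∀ m : ℕ, 2 * α ≠ -((m : ℝ) + 1)) (n : ℕ) :
    PowerSeries.coeff n (maclaurin fun w => Real.exp (-w) * tildeI α w)
      = (Real.Gamma (α + 1))⁻¹ * ((ascPochhammer ℝ n).eval (α + 1 / 2) * (-2) ^ n /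
          ((ascPochhammer ℝ n).eval (2 * α + 1) * (n.factorial : ℝ))) := by
  have hexp : AnalyticAt ℝ (fun w : ℝ => Real.exp (-w)) 0 := by fun_prop
  set y := maclaurin (tildeI α) with hy
  set e := maclaurin (fun t => Real.exp (-t)) with he
  set f := maclaurin fun w => Real.exp (-w) * tildeI α w with hf
  have hfe : f = e * y := maclaurin_mul hexp (analyticAt_tildeI α)
  have hde : PowerSeries.derivative ℝ e = -e := by
    ext n
    rw [he, maclaurin_exp_neg, PowerSeries.coeff_derivative, map_neg, PowerSeries.coeff_mk,
      PowerSeries.coeff_mk, Nat.factorial_succ]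
    have h1 : (n.factorial : ℝ) ≠ 0 := by positivity
    have h2 : (n : ℝ) + 1 ≠ 0 := by positivity
    push_cast
    field_simp
    ring
  have hode := maclaurin_tildeI_ode hα
  rw [← hy] at hode
  have hd1 : PowerSeries.derivative ℝ f = -f + e * PowerSeries.derivative ℝ y := by
    rw [hfe, Derivation.leibniz, hde, smul_eq_mul, smul_eq_mul]
    ring
  have hd2 : PowerSeries.derivative ℝ (PowerSeries.derivative ℝ f)
      = -PowerSeries.derivative ℝ f - e * PowerSeries.derivative ℝ y
        + e * PowerSeries.derivative ℝ (PowerSeries.derivative ℝ y) := by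
    conv_lhs => rw [hd1]
    rw [map_add, map_neg, Derivation.leibniz, hde, smul_eq_mul, smul_eq_mul]
    ring
  have hC : PowerSeries.X * PowerSeries.derivative ℝ (PowerSeries.derivative ℝ f)
      + PowerSeries.C 2 * (PowerSeries.X * PowerSeries.derivative ℝ f)
      + PowerSeries.C (2 * α + 1) * PowerSeries.derivative ℝ f + PowerSeries.C (2 * α + 1) * f
      = 0 := by
    have h2 : (PowerSeries.C (2 : ℝ)) = 2 := map_ofNat _ 2
    have hed : e * PowerSeries.derivative ℝ y = PowerSeries.derivative ℝ f + f := by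
      rw [hd1]; ring
    rw [hd2, h2]
    linear_combination e * hode - PowerSeries.X * hfe
      + (-PowerSeries.X - PowerSeries.C (2 * α + 1)) * hed
  have hrec : ∀ n : ℕ, PowerSeries.coeff (n + 1) f * ((n : ℝ) + 1) * (2 * α + 1 + n)
      = PowerSeries.coeff n f * (-2) * (α + 1 / 2 + n) := by
    intro n
    obtain ⟨q, hq⟩ : ∃ q, q = 2 * α + 1 := ⟨_, rfl⟩
    rw [← hq] at hC
    have h := congrArg (PowerSeries.coeff n) hC
    simp only [map_add, PowerSeries.coeff_C_mul, map_zero, PowerSeries.coeff_derivative] at h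
    rw [show α + 1 / 2 + n = q / 2 + n by rw [hq]; ring, ← hq]
    rcases n with _ | n
    · simp only [PowerSeries.coeff_zero_X_mul] at h
      push_cast at h ⊢
      linear_combination h
    · simp only [PowerSeries.coeff_succ_X_mul, PowerSeries.coeff_derivative] at h
      push_cast at h ⊢
      linear_combination h
  have hpoch : ∀ n : ℕ, (ascPochhammer ℝ n).eval (2 * α + 1) ≠ 0 := by
    intro n
    induction n with
    | zero => simp
    | succ n ih =>
      rw [ascPochhammer_succ_eval]
      exact mul_ne_zero ih fun h0 => hα' n (by linarith)
  induction n with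
  | zero =>
    rw [hfe, PowerSeries.coeff_zero_eq_constantCoeff_apply, map_mul, he, maclaurin_exp_neg, hy,
      maclaurin_tildeI]
    simp [tildeICoeff]
  | succ n ih =>
    have h1 : (n : ℝ) + 1 ≠ 0 := by positivity
    have h2 : 2 * α + 1 + n ≠ 0 := fun h0 => hα' n (by linarith)
    have h3 : (n.factorial : ℝ) ≠ 0 := by positivity
    have h4 := hpoch n
    have h5 := hrec n
    rw [ih] at h5
    rw [ascPochhammer_succ_eval, ascPochhammer_succ_eval, Nat.factorial_succ]
    push_cast
    apply mul_right_cancel₀ (mul_ne_zero h1 h2)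
    rw [← mul_assoc, h5]
    generalize (ascPochhammer ℝ n).eval (2 * α + 1) = D at h4 ⊢
    generalize 2 * α + 1 + n = q at h2 ⊢
    field_simp
    ring

lemma exp_neg_mul_cosh_mul_exp_le {z : ℝ} (hz : 0 < z) (b : ℝ) {s : ℝ} (hs : 0 ≤ s) :
    Real.exp (-z * Real.cosh s) * Real.exp (b * s)
      ≤ Real.exp ((b + 1) ^ 2 / z) * Real.exp (-s) := by
  rw [← Real.exp_add, ← Real.exp_add, Real.exp_le_exp]
  have h1 : s ^ 2 / 4 ≤ Real.cosh s := by
    rw [Real.cosh_eq]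
    have := Real.quadratic_le_exp_of_nonneg hs
    have := Real.exp_pos (-s)
    linarith
  have h2 : z * (s ^ 2 / 4) ≤ z * Real.cosh s := by gcongr
  have h3 : 0 ≤ (z * s / 2 - (b + 1)) ^ 2 / z := by positivity
  have h4 : (z * s / 2 - (b + 1)) ^ 2 / z = z * (s ^ 2 / 4) - (b + 1) * s + (b + 1) ^ 2 / z := by
    field_simp
    ring
  linarith

lemma cosh_mul_le_exp (α : ℝ) {s : ℝ} (hs : 0 ≤ s) : Real.cosh (α * s) ≤ Real.exp (|α| * s) := by
  rw [← Real.cosh_abs, abs_mul, abs_of_nonneg hs, Real.cosh_eq]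
  have : Real.exp (-(|α| * s)) ≤ Real.exp (|α| * s) := by
    rw [Real.exp_le_exp]
    have : 0 ≤ |α| * s := by positivity
    linarith
  linarith

lemma abs_sinh_le_cosh (x : ℝ) : |Real.sinh x| ≤ Real.cosh x := by
  rw [← abs_of_pos (Real.cosh_pos x), ← sq_le_sq]
  linarith [Real.cosh_sq x]

lemma integrableOn_besselK {z : ℝ} (hz : 0 < z) (α : ℝ) :
    IntegrableOn (fun s => Real.exp (-z * Real.cosh s) * Real.cosh (α * s)) (Ioi 0) := by
  refine Integrable.mono' ((integrableOn_exp_neg_Ioi 0).const_mul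
    (Real.exp ((|α| + 1) ^ 2 / z))) ?_ ?_
  · refine Continuous.aestronglyMeasurable ?_
    fun_prop
  · filter_upwards [self_mem_ae_restrict measurableSet_Ioi] with s hs
    have hs' : 0 ≤ s := le_of_lt hs
    rw [Real.norm_eq_abs, abs_of_pos (mul_pos (Real.exp_pos _) (Real.cosh_pos _))]
    refine le_trans ?_ (exp_neg_mul_cosh_mul_exp_le hz |α| hs')
    gcongr
    exact cosh_mul_le_exp α hs'

lemma tendsto_exp_neg_mul_cosh_mul_sinh {z : ℝ} (hz : 0 < z) (α : ℝ) :
    Tendsto (fun s => Real.exp (-z * Real.cosh s) * Real.sinh (α * s)) atTop (𝓝 0) := by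
  have h := (Real.tendsto_exp_neg_atTop_nhds_zero).const_mul (Real.exp ((|α| + 1) ^ 2 / z))
  rw [mul_zero] at h
  refine squeeze_zero_norm' ?_ h
  filter_upwards [eventually_ge_atTop 0] with s hs
  rw [norm_mul, Real.norm_eq_abs, Real.norm_eq_abs, abs_of_pos (Real.exp_pos _)]
  refine le_trans ?_ (exp_neg_mul_cosh_mul_exp_le hz |α| hs)
  gcongr
  exact (abs_sinh_le_cosh _).trans (cosh_mul_le_exp α hs)

lemma besselK_neg (α z : ℝ) : besselK (-α) z = besselK α z := by
  simp [besselK, neg_mul, Real.cosh_neg]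

/-- The three-term recurrence of the K-Bessel function. -/
lemma besselK_add_one {z : ℝ} (hz : 0 < z) (α : ℝ) :
    besselK (α + 1) z = besselK (α - 1) z + 2 * α / z * besselK α z := by
  have hI := integrableOn_besselK hz
  have hderiv : ∀ s : ℝ, HasDerivAt (fun s => Real.exp (-z * Real.cosh s) * Real.sinh (α * s))
      (α * (Real.exp (-z * Real.cosh s) * Real.cosh (α * s))
        - (z / 2 * (Real.exp (-z * Real.cosh s) * Real.cosh ((α + 1) * s))
          - z / 2 * (Real.exp (-z * Real.cosh s) * Real.cosh ((α - 1) * s)))) s := by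
    intro s
    have h1 := ((Real.hasDerivAt_cosh s).const_mul (-z)).exp
    have h2 := ((hasDerivAt_id s).const_mul α).sinh
    refine (h1.mul h2).congr_deriv ?_
    rw [add_mul, sub_mul, one_mul, Real.cosh_add, Real.cosh_sub]
    simp only [id]
    ring
  have h := integral_Ioi_of_hasDerivAt_of_tendsto
    (hderiv 0).continuousAt.continuousWithinAt (fun s _ => hderiv s)
    (((hI α).const_mul α).sub (((hI (α + 1)).const_mul (z / 2)).sub
      ((hI (α - 1)).const_mul (z / 2)))) (tendsto_exp_neg_mul_cosh_mul_sinh hz α)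
  rw [integral_sub, integral_sub, integral_const_mul, integral_const_mul, integral_const_mul] at h
  · change α * besselK α z - (z / 2 * besselK (α + 1) z - z / 2 * besselK (α - 1) z) = _ at h
    rw [mul_zero, Real.sinh_zero, mul_zero, sub_zero] at h
    field_simp
    linarith
  · exact (hI (α + 1)).const_mul (z / 2)
  · exact (hI (α - 1)).const_mul (z / 2)
  · exact (hI α).const_mul α
  · exact ((hI (α + 1)).const_mul (z / 2)).sub ((hI (α - 1)).const_mul (z / 2))

lemma besselK_half {z : ℝ} (hz : 0 < z) :
    besselK (1 / 2) z = √(Real.pi / (2 * z)) * Real.exp (-z) := by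
  have hfun : (fun s => ((fun u => 2 * Real.exp (-z) * Real.exp (-(2 * z) * u ^ 2)) ∘
        fun s => Real.sinh (s / 2)) s * (Real.cosh (s / 2) / 2))
      = fun s => Real.exp (-z * Real.cosh s) * Real.cosh (1 / 2 * s) := by
    funext s
    have h1 : Real.cosh s = 1 + 2 * Real.sinh (s / 2) ^ 2 := by
      have h := Real.cosh_two_mul (s / 2)
      rw [mul_div_cancel₀ s two_ne_zero, Real.cosh_sq] at h
      rw [h]
      ring
    rw [h1, show -z * (1 + 2 * Real.sinh (s / 2) ^ 2) = -z + -(2 * z) * Real.sinh (s / 2) ^ 2 by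
      ring, Real.exp_add, show 1 / 2 * s = s / 2 by ring]
    simp only [Function.comp]
    ring
  have htend : Tendsto (fun s : ℝ => Real.sinh (s / 2)) atTop atTop := by
    refine tendsto_atTop_mono' _ ?_ (tendsto_id.atTop_div_const (two_pos : (0 : ℝ) < 2))
    filter_upwards [eventually_ge_atTop 0] with s hs
    exact Real.self_le_sinh_iff.mpr (by positivity)
  have h := integral_comp_mul_deriv_Ioi (f := fun s => Real.sinh (s / 2))
    (f' := fun s => Real.cosh (s / 2) / 2)
    (g := fun u => 2 * Real.exp (-z) * Real.exp (-(2 * z) * u ^ 2)) (a := 0)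
    (by fun_prop) htend
    (fun s _ => by
      have h := ((hasDerivAt_id s).div_const 2).sinh
      refine (h.congr_deriv ?_).hasDerivWithinAt
      simp only [id]
      ring)
    (by fun_prop)
    ((integrable_exp_neg_mul_sq (by positivity)).const_mul _).integrableOn
    (by rw [hfun, integrableOn_Ici_iff_integrableOn_Ioi]; exact integrableOn_besselK hz _)
  rw [hfun, zero_div, Real.sinh_zero, integral_const_mul, integral_gaussian_Ioi] at h
  rw [besselK, h]
  ring

/-- The reverse Bessel-type polynomial occurring in K-Bessel functions of half-integer order. -/
def revBesselPoly (N : ℕ) (y : ℝ) : ℝ :=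
  ∑ i ∈ Finset.range (N + 1),
    ((2 * N - i).factorial : ℝ) / (((N - i).factorial : ℝ) * (i.factorial : ℝ)) * y ^ i

lemma revBesselPoly_add_two (N : ℕ) (y : ℝ) :
    revBesselPoly (N + 2) y
      = y ^ 2 * revBesselPoly N y + 2 * (2 * N + 3) * revBesselPoly (N + 1) y := by
  have hf : ∀ n : ℕ, (n.factorial : ℝ) ≠ 0 := fun n => by positivity
  have hcoeff : ∀ k ∈ Finset.range N,
      ((2 * (N + 2) - (k + 2)).factorial : ℝ) /
          (((N + 2 - (k + 2)).factorial : ℝ) * ((k + 2).factorial : ℝ)) * y ^ (k + 2)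
        = y ^ 2 * (((2 * N - k).factorial : ℝ) /
            (((N - k).factorial : ℝ) * (k.factorial : ℝ)) * y ^ k)
          + 2 * (2 * N + 3) * (((2 * (N + 1) - (k + 2)).factorial : ℝ) /
            (((N + 1 - (k + 2)).factorial : ℝ) * ((k + 2).factorial : ℝ)) * y ^ (k + 2)) := by
    intro k hk
    obtain ⟨m, rfl⟩ := Nat.exists_eq_add_of_lt (Finset.mem_range.mp hk)
    rw [show 2 * (k + m + 1 + 2) - (k + 2) = k + 2 * m + 2 + 1 + 1 by omega,
      show k + m + 1 + 2 - (k + 2) = m + 1 by omega,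
      show 2 * (k + m + 1) - k = k + 2 * m + 2 by omega,
      show k + m + 1 - k = m + 1 by omega,
      show 2 * (k + m + 1 + 1) - (k + 2) = k + 2 * m + 2 by omega,
      show k + m + 1 + 1 - (k + 2) = m by omega]
    rw [Nat.factorial_succ (k + 2 * m + 2 + 1), Nat.factorial_succ (k + 2 * m + 2),
      Nat.factorial_succ m, Nat.factorial_succ (k + 1), Nat.factorial_succ k]
    have h1 := hf m
    have h2 := hf k
    have h3 : (m : ℝ) + 1 ≠ 0 := by positivity
    have h4 : (k : ℝ) + 1 ≠ 0 := by positivity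
    have h5 : (k : ℝ) + 1 + 1 ≠ 0 := by positivity
    generalize (k + 2 * m + 2).factorial = F
    push_cast
    field_simp
    ring
  have h0 : ((2 * (N + 2)).factorial : ℝ) / ((N + 2).factorial : ℝ)
      = 2 * (2 * N + 3) * (((2 * (N + 1)).factorial : ℝ) / ((N + 1).factorial : ℝ)) := by
    rw [show 2 * (N + 2) = 2 * (N + 1) + 1 + 1 by ring, Nat.factorial_succ (2 * (N + 1) + 1),
      Nat.factorial_succ (2 * (N + 1)), Nat.factorial_succ (N + 1)]
    have h1 := hf (N + 1)
    have h2 : (N : ℝ) + 1 + 1 ≠ 0 := by positivity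
    push_cast
    field_simp
    ring
  have h1 : ((2 * (N + 2) - 1).factorial : ℝ) / ((N + 1).factorial : ℝ)
      = 2 * (2 * N + 3) * (((2 * (N + 1) - 1).factorial : ℝ) / (N.factorial : ℝ)) := by
    rw [show 2 * (N + 2) - 1 = 2 * N + 1 + 1 + 1 by omega,
      show 2 * (N + 1) - 1 = 2 * N + 1 by omega, Nat.factorial_succ (2 * N + 1 + 1),
      Nat.factorial_succ (2 * N + 1), Nat.factorial_succ N]
    have h1 := hf N
    have h2 : (N : ℝ) + 1 ≠ 0 := by positivity
    push_cast
    field_simp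
    ring
  have hlast : ∀ n : ℕ, ((2 * n - n).factorial : ℝ) /
      (((n - n).factorial : ℝ) * (n.factorial : ℝ)) = 1 := fun n => by
    rw [show 2 * n - n = n by omega, Nat.sub_self, Nat.factorial_zero, Nat.cast_one, one_mul,
      div_self (hf n)]
  rw [revBesselPoly, revBesselPoly, revBesselPoly, Finset.sum_range_succ, hlast,
    Finset.sum_range_succ', Finset.sum_range_succ', Finset.sum_congr rfl hcoeff,
    Finset.sum_add_distrib, ← Finset.mul_sum, ← Finset.mul_sum,
    Finset.sum_range_succ _ N, hlast, Finset.sum_range_succ' _ (N + 1),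
    Finset.sum_range_succ' _ N]
  simp only [zero_add, Nat.sub_zero, Nat.factorial_zero, Nat.factorial_one, Nat.cast_one, mul_one,
    pow_zero, pow_one, Nat.add_sub_cancel, show N + 2 - 1 = N + 1 from rfl]
  rw [h0, h1]
  ring

/-- The K-Bessel function of half-integer order in closed form. -/
lemma besselK_nat_add_half {z : ℝ} (hz : 0 < z) (N : ℕ) :
    besselK (N + 1 / 2) z
      = √(Real.pi / (2 * z)) * Real.exp (-z) * (revBesselPoly N (2 * z) / (2 * z) ^ N) := by
  induction N using Nat.twoStepInduction with
  | zero => simpa [revBesselPoly] using besselK_half hz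
  | one =>
    have h := besselK_add_one hz (1 / 2)
    rw [show (1 / 2 - 1 : ℝ) = -(1 / 2) by norm_num, besselK_neg, besselK_half hz] at h
    rw [Nat.cast_one, add_comm, h]
    simp [revBesselPoly, Finset.sum_range_succ]
    field_simp
    ring
  | more N h1 h2 =>
    have h := besselK_add_one hz ((N + 1 : ℕ) + 1 / 2)
    rw [show ((N + 1 : ℕ) : ℝ) + 1 / 2 - 1 = N + 1 / 2 by push_cast; ring, h1, h2] at h
    rw [show ((N + 2 : ℕ) : ℝ) + 1 / 2 = (N + 1 : ℕ) + 1 / 2 + 1 by push_cast; ring, h,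
      revBesselPoly_add_two]
    push_cast
    field_simp
    ring

lemma tildeK_half_odd {z : ℝ} (hz : 0 < z) (N : ℕ) :
    tildeK (((2 * N + 1 : ℕ) : ℝ) / 2) z
      = √Real.pi * Real.exp (-z) * revBesselPoly N (2 * z) / z ^ (2 * N + 1) := by
  have h1 : √(z / 2) * √(2 * z) = z := by
    rw [← Real.sqrt_mul (by positivity), show z / 2 * (2 * z) = z ^ 2 by ring,
      Real.sqrt_sq hz.le]
  have h2 : 0 < √(z / 2) := Real.sqrt_pos.mpr (by positivity)
  have h3 : 0 < √(2 * z) := Real.sqrt_pos.mpr (by positivity)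
  have h4 : z ^ (2 * N + 1) = (z / 2) ^ N * (2 * z) ^ N * (√(z / 2) * √(2 * z)) := by
    rw [h1, ← mul_pow, show z / 2 * (2 * z) = z ^ 2 by ring, ← pow_mul, pow_succ]
  have h5 : √(Real.pi / (2 * z)) = √Real.pi / √(2 * z) := Real.sqrt_div' _ (by positivity)
  rw [tildeK, show ((2 * N + 1 : ℕ) : ℝ) / 2 = N + 1 / 2 by push_cast; ring,
    besselK_nat_add_half hz, Real.rpow_neg (by positivity), Real.rpow_add (by positivity),
    Real.rpow_natCast, ← Real.sqrt_eq_rpow, h5, h4]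
  generalize √(z / 2) = a at h2 ⊢
  generalize √(2 * z) = b at h3 ⊢
  field_simp

lemma Gamma_nat_add {s : ℝ} (hs : ∀ m : ℕ, s ≠ -(m : ℝ)) (n : ℕ) :
    Real.Gamma (n + s) = (ascPochhammer ℝ n).eval s * Real.Gamma s := by
  induction n with
  | zero => simp
  | succ n ih =>
    have h : (n : ℝ) + s ≠ 0 := fun h => hs n (by linarith)
    rw [ascPochhammer_succ_eval, Nat.cast_succ, add_right_comm, Real.Gamma_add_one h, ih]
    ring

lemma ascPochhammer_eval_ne_zero {s : ℝ} (hs : ∀ m : ℕ, s ≠ -(m : ℝ)) (n : ℕ) :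
    (ascPochhammer ℝ n).eval s ≠ 0 := by
  induction n with
  | zero => simp
  | succ n ih =>
    rw [ascPochhammer_succ_eval]
    exact mul_ne_zero ih fun h => hs n (by linarith)

lemma analyticAt_one_sub_pow (m : ℕ) : AnalyticAt ℝ (fun t : ℝ => (1 - t) ^ m) 0 := by
  fun_prop

lemma coeff_maclaurin_one_sub_pow (m k : ℕ) :
    PowerSeries.coeff k (maclaurin fun t => (1 - t) ^ m) = (-1) ^ k * (m.choose k : ℝ) := by
  have h : ∀ z : ℝ, HasSum (fun k => ((-1) ^ k * (m.choose k : ℝ)) * z ^ k) ((1 - z) ^ m) := by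
    intro z
    have hsum : (1 - z) ^ m
        = ∑ k ∈ Finset.range (m + 1), ((-1) ^ k * (m.choose k : ℝ)) * z ^ k := by
      rw [sub_eq_neg_add, add_pow]
      refine Finset.sum_congr rfl fun k _ => ?_
      rw [neg_pow z k, one_pow]
      ring
    rw [hsum]
    refine hasSum_sum_of_ne_finset_zero fun k hk => ?_
    rw [Nat.choose_eq_zero_of_lt (by simpa [Nat.lt_succ_iff] using hk)]
    simp
  rw [(analyticAt_and_maclaurin_of_hasSum h).2, PowerSeries.coeff_mk]

/-- The generating function of the Laguerre polynomials `L_n^μ(2x)` weighted by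
`Γ(n+(μ+1)/2)/Γ(n+μ+1)`. -/
lemma coeff_maclaurin_laguerre {μ : ℝ} (hμ : ∀ n : ℕ, μ ≠ -((n : ℝ) + 1)) (x : ℝ) (n : ℕ) :
    PowerSeries.coeff n (maclaurin fun t => (1 - t) ^ (-((μ + 1) / 2)) *
        (Real.exp (-(t * x / (1 - t))) * tildeI (μ / 2) (t * x / (1 - t))))
      = 2 ^ μ / √Real.pi * (Real.Gamma (n + (μ + 1) / 2) / Real.Gamma (n + (μ + 1))) *
          laguerreL n μ (2 * x) := by
  have hα : ∀ m : ℕ, μ / 2 ≠ -((m : ℝ) + 1) := fun m h => hμ (2 * m + 1) (by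
    push_cast; linarith)
  have hα' : ∀ m : ℕ, 2 * (μ / 2) ≠ -((m : ℝ) + 1) := fun m h => hμ m (by linarith)
  have hl : ∀ m : ℕ, (μ + 1) / 2 ≠ -(m : ℝ) := fun m h => hμ (2 * m) (by
    push_cast; linarith)
  have hm : ∀ m : ℕ, μ + 1 ≠ -(m : ℝ) := fun m h => hμ m (by linarith)
  have hG2 : Real.Gamma (μ + 1) ≠ 0 := Real.Gamma_ne_zero hm
  have hpi : √Real.pi ≠ 0 := by positivity
  have hdup : Real.Gamma ((μ + 1) / 2) * 2 ^ μ / (√Real.pi * Real.Gamma (μ + 1))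
      = (Real.Gamma (μ / 2 + 1))⁻¹ := by
    have h := Real.Gamma_mul_Gamma_add_half ((μ + 1) / 2)
    rw [show (μ + 1) / 2 + 1 / 2 = μ / 2 + 1 by ring, show 2 * ((μ + 1) / 2) = μ + 1 by ring,
      show 1 - (μ + 1) = -μ by ring, Real.rpow_neg two_pos.le] at h
    refine eq_inv_of_mul_eq_one_left ?_
    rw [div_mul_eq_mul_div, div_eq_one_iff_eq (mul_ne_zero hpi hG2), mul_right_comm, h]
    field_simp
  have hΦ : AnalyticAt ℝ (fun w => Real.exp (-w) * tildeI (μ / 2) w) 0 :=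
    (by fun_prop : AnalyticAt ℝ (fun w : ℝ => Real.exp (-w)) 0).mul (analyticAt_tildeI _)
  rw [coeff_maclaurin_one_sub_rpow_mul_comp hΦ, Gamma_nat_add hl, Gamma_nat_add hm, laguerreL,
    show ∀ a b c d e f g : ℝ, a / b * (c * d / (e * f)) * g = d * a / (b * f) * (c / e * g) from
      fun a b c d e f g => by ring, hdup]
  simp only [Finset.mul_sum]
  refine Finset.sum_congr rfl fun k hk => ?_
  obtain ⟨m, rfl⟩ := Nat.exists_eq_add_of_le (Nat.lt_succ_iff.mp (Finset.mem_range.mp hk))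
  rw [coeff_maclaurin_exp_neg_mul_tildeI hα hα', show μ / 2 + 1 / 2 = (μ + 1) / 2 by ring,
    show 2 * (μ / 2) + 1 = μ + 1 by ring, Nat.add_sub_cancel_left,
    Nat.cast_choose ℝ (Nat.le_add_right k m), Nat.add_sub_cancel_left, ascPochhammer_eval_add k m
      ((μ + 1) / 2), mul_pow]
  have h1 := ascPochhammer_eval_ne_zero hm k
  have h2 := ascPochhammer_eval_ne_zero hm (k + m)
  have h3 : (k.factorial : ℝ) ≠ 0 := by positivity
  have h4 : (m.factorial : ℝ) ≠ 0 := by positivity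
  have h5 : ((k + m).factorial : ℝ) ≠ 0 := by positivity
  have h6 : (-2 : ℝ) ^ k = (-1) ^ k * 2 ^ k := by rw [← mul_pow]; norm_num
  rw [h6]
  field_simp

lemma genG₂_half_odd_eventuallyEq (μ : ℝ) (N : ℕ) {x : ℝ} (hx : 0 < x) :
    (fun t => genG₂ μ ((2 * N + 1 : ℕ) : ℝ) t x) =ᶠ[𝓝 0] fun t =>
      ∑ i ∈ Finset.range (N + 1),
        (√Real.pi * Real.exp (-x) / x ^ (2 * N + 1) *
          (((2 * N - i).factorial : ℝ) / (((N - i).factorial : ℝ) * (i.factorial : ℝ)) *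
            (2 * x) ^ i)) *
        ((1 - t) ^ (N - i) * ((1 - t) ^ (-((μ + 1) / 2)) *
          (Real.exp (-(t * x / (1 - t))) * tildeI (μ / 2) (t * x / (1 - t))))) := by
  filter_upwards [eventually_lt_nhds (zero_lt_one' ℝ)] with t ht
  have ht' : 0 < 1 - t := by linarith
  have hz : 0 < x / (1 - t) := by positivity
  have hexp : Real.exp (-(x / (1 - t))) = Real.exp (-x) * Real.exp (-(t * x / (1 - t))) := by
    rw [← Real.exp_add]
    congr 1
    field_simp
    ring
  have hpow : (1 - t) ^ (-(μ + ((2 * N + 1 : ℕ) : ℝ) + 2) / 2)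
      = (1 - t) ^ (-((μ + 1) / 2)) / (1 - t) ^ (N + 1) := by
    rw [← Real.rpow_natCast (1 - t) (N + 1), ← Real.rpow_sub ht']
    congr 1
    push_cast
    ring
  rw [genG₂, tildeK_half_odd hz, hpow, hexp, revBesselPoly, Finset.mul_sum, Finset.sum_div,
    Finset.mul_sum]
  refine Finset.sum_congr rfl fun i hi => ?_
  obtain ⟨m, rfl⟩ := Nat.exists_eq_add_of_le (Nat.lt_succ_iff.mp (Finset.mem_range.mp hi))
  rw [Nat.add_sub_cancel_left, ← mul_div_assoc 2 x, div_pow, div_pow]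
  have h1 := ht'.ne'
  field_simp
  ring

lemma Lambda₂_half_odd {μ : ℝ} (hμ : ∀ n : ℕ, μ ≠ -((n : ℝ) + 1)) (N j : ℕ) {x : ℝ}
    (hx : 0 < x) :
    Lambda₂ μ ((2 * N + 1 : ℕ) : ℝ) j x
      = 2 ^ μ * Real.exp (-x) / x ^ (2 * N + 1) *
        ∑ i ∈ Finset.range (N + 1), ∑ k ∈ Finset.range (j + 1),
          ((2 * N - i).factorial : ℝ) / (((N - i).factorial : ℝ) * (i.factorial : ℝ)) *
            (2 * x) ^ i * ((-1) ^ k * ((N - i).choose k : ℝ) *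
            (Real.Gamma ((j - k : ℕ) + (μ + 1) / 2) / Real.Gamma ((j - k : ℕ) + (μ + 1)) *
              laguerreL (j - k) μ (2 * x))) := by
  have hw : AnalyticAt ℝ (fun t : ℝ => t * x / (1 - t)) 0 :=
    AnalyticAt.div (by fun_prop) (by fun_prop) (by norm_num)
  have hI : AnalyticAt ℝ (fun t : ℝ => tildeI (μ / 2) (t * x / (1 - t))) 0 :=
    AnalyticAt.fun_comp (g := tildeI (μ / 2)) (by simpa using analyticAt_tildeI (μ / 2)) hw
  have hL : AnalyticAt ℝ (fun t => (1 - t) ^ (-((μ + 1) / 2)) *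
      (Real.exp (-(t * x / (1 - t))) * tildeI (μ / 2) (t * x / (1 - t)))) 0 :=
    (analyticAt_one_sub_rpow _).mul ((AnalyticAt.rexp' hw.neg).mul hI)
  rw [Lambda₂, ← coeff_maclaurin, maclaurin_congr (genG₂_half_odd_eventuallyEq μ N hx),
    maclaurin_sum, map_sum, Finset.mul_sum]
  · refine Finset.sum_congr rfl fun i _ => ?_
    rw [maclaurin_const_mul, PowerSeries.coeff_C_mul, maclaurin_mul (analyticAt_one_sub_pow _) hL,
      PowerSeries.coeff_mul, Finset.Nat.sum_antidiagonal_eq_sum_range_succ_mk, Finset.mul_sum,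
      Finset.mul_sum]
    refine Finset.sum_congr rfl fun k _ => ?_
    rw [coeff_maclaurin_one_sub_pow, coeff_maclaurin_laguerre hμ]
    have hpi : √Real.pi ≠ 0 := by positivity
    field_simp
  · exact fun i _ => analyticAt_const.mul ((analyticAt_one_sub_pow _).mul hL)

/-- The Laguerre polynomial as a formal polynomial. -/
def laguerrePoly (n : ℕ) (α : ℝ) : Polynomial ℝ :=
  ∑ k ∈ Finset.range (n + 1), Polynomial.C ((ascPochhammer ℝ n).eval (α + 1) / (n.factorial : ℝ) *
    ((n.choose k : ℝ) * ((-1) ^ k / (ascPochhammer ℝ k).eval (α + 1)))) * Polynomial.X ^ k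

lemma eval_laguerrePoly (n : ℕ) (α x : ℝ) : (laguerrePoly n α).eval x = laguerreL n α x := by
  rw [laguerrePoly, laguerreL, Polynomial.eval_finsetSum, Finset.mul_sum]
  refine Finset.sum_congr rfl fun k _ => ?_
  simp
  ring

lemma natDegree_laguerrePoly_le (n : ℕ) (α : ℝ) : (laguerrePoly n α).natDegree ≤ n :=
  Polynomial.natDegree_sum_le_of_forall_le _ _ fun _ hk =>
    (Polynomial.natDegree_C_mul_X_pow_le _ _).trans (Nat.lt_succ_iff.mp (Finset.mem_range.mp hk))

lemma coeff_laguerrePoly_ne_zero {α : ℝ} (hα : ∀ m : ℕ, α + 1 ≠ -(m : ℝ)) (n : ℕ) :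
    (laguerrePoly n α).coeff n ≠ 0 := by
  have h := ascPochhammer_eval_ne_zero hα n
  rw [laguerrePoly, Polynomial.finsetSum_coeff, Finset.sum_eq_single n]
  · simp [h, Nat.factorial_ne_zero]
  · intro k _ hk
    rw [Polynomial.coeff_C_mul, Polynomial.coeff_X_pow, if_neg hk.symm, mul_zero]
  · simp

/-- A combination of the products `L_{j-k}^α·X^i` with `i + k ≤ N` has degree `j + N` as soon as
its leading coefficient does not vanish. -/
lemma natDegree_sum_laguerrePoly {α : ℝ} (hα : ∀ m : ℕ, α + 1 ≠ -(m : ℝ)) (c : ℕ → ℕ → ℝ)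
    (N j : ℕ) (hc : c 0 N ≠ 0) :
    (∑ k ∈ Finset.range (j + 1), ∑ i ∈ Finset.range (N + 1 - k),
      Polynomial.C (c k i) * laguerrePoly (j - k) α * Polynomial.X ^ i).natDegree = j + N := by
  have hdeg : ∀ k i, (Polynomial.C (c k i) * laguerrePoly (j - k) α
      * Polynomial.X ^ i).natDegree ≤ j - k + i := fun k i =>
    Polynomial.natDegree_mul_le_of_le ((Polynomial.natDegree_C_mul_le _ _).trans
      (natDegree_laguerrePoly_le _ _)) (Polynomial.natDegree_X_pow_le i)
  refine Polynomial.natDegree_eq_of_le_of_coeff_ne_zero ?_ ?_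
  · refine Polynomial.natDegree_sum_le_of_forall_le _ _ fun k hk =>
      Polynomial.natDegree_sum_le_of_forall_le _ _ fun i hi => (hdeg k i).trans ?_
    simp only [Finset.mem_range] at hk hi
    omega
  · rw [Polynomial.finsetSum_coeff, Finset.sum_eq_single 0, Polynomial.finsetSum_coeff,
      Finset.sum_eq_single N]
    · rw [Polynomial.coeff_mul_X_pow, Polynomial.coeff_C_mul]
      exact mul_ne_zero hc (coeff_laguerrePoly_ne_zero hα _)
    · intro i hi hiN
      refine Polynomial.coeff_eq_zero_of_natDegree_lt ((hdeg 0 i).trans_lt ?_)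
      simp only [Finset.mem_range] at hi
      omega
    · simp
    · intro k hk hk0
      rw [Polynomial.finsetSum_coeff]
      refine Finset.sum_eq_zero fun i hi =>
        Polynomial.coeff_eq_zero_of_natDegree_lt ((hdeg k i).trans_lt ?_)
      simp only [Finset.mem_range] at hk hi
      omega
    · simp

/-- For `μ ∉ {−1,−2,−3,…}` and odd `ν ≥ 1`,
`Λ_{2,j}^{μ,ν}(x) = (2^μ·Γ(j+(μ+1)/2)/Γ(j+μ+1))·x^{−ν}·e^{−x}·M_j^{μ,ν}(2x)`, where
`M_j^{μ,ν}` is a polynomial of degree `j+(ν−1)/2`. -/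
theorem statement14 (μ : ℝ) (hμ : ∀ n : ℕ, μ ≠ -((n : ℝ) + 1))
    (ν : ℕ) (hν : Odd ν) (hν1 : 1 ≤ ν) (j : ℕ) :
    (∀ x : ℝ, 0 < x →
      Lambda₂ μ (ν : ℝ) j x
        = 2 ^ μ * Real.Gamma ((j : ℝ) + (μ + 1) / 2) / Real.Gamma ((j : ℝ) + μ + 1) *
            (x ^ (-(ν : ℝ)) * Real.exp (-x) * polyM μ ν j (2 * x))) ∧
    (∃ P : Polynomial ℝ, P.natDegree = j + (ν - 1) / 2 ∧
      ∀ x : ℝ, polyM μ ν j x = P.eval x) := by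
  obtain ⟨N, rfl⟩ := hν
  have hN : (2 * N + 1 - 1) / 2 = N := by omega
  have hl : Real.Gamma ((j : ℝ) + (μ + 1) / 2) ≠ 0 := Real.Gamma_ne_zero fun m h =>
    hμ (2 * (j + m)) (by push_cast; linarith)
  have hm : Real.Gamma ((j : ℝ) + μ + 1) ≠ 0 := Real.Gamma_ne_zero fun m h =>
    hμ (j + m) (by push_cast; linarith)
  rw [hN]
  refine ⟨fun x hx => ?_, ?_⟩
  · rw [Lambda₂_half_odd hμ N j hx, Finset.sum_comm, polyM, hN, Real.rpow_neg hx.le,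
      Real.rpow_natCast, show ∀ a b c d e S : ℝ, a * b / c * (d * e * (c / b * S))
        = (a * e * d) * (b / b) * (c / c) * S from fun a b c d e S => by ring, div_self hl,
      div_self hm, mul_one, mul_one, ← div_eq_mul_inv]
    congr 1
    refine Finset.sum_congr rfl fun k _ => ?_
    rw [← Finset.sum_subset (Finset.range_mono (Nat.sub_le (N + 1) k))]
    · refine Finset.sum_congr rfl fun i hi => ?_
      have hi' : k ≤ N - i := by
        have := Finset.mem_range.mp hi
        omega
      rw [Nat.cast_choose ℝ hi', show 2 * N + 1 - i - 1 = 2 * N - i by omega, ← add_assoc]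
      have h1 : ((N - i).factorial : ℝ) ≠ 0 := by positivity
      field_simp
    · intro i hi hik
      simp only [Finset.mem_range] at hi hik
      rw [Nat.choose_eq_zero_of_lt (by omega : N - i < k)]
      simp
  · have hα : ∀ m : ℕ, μ + 1 ≠ -(m : ℝ) := fun m h => hμ m (by linarith)
    refine ⟨Polynomial.C (Real.Gamma ((j : ℝ) + μ + 1) / Real.Gamma ((j : ℝ) + (μ + 1) / 2)) *
      ∑ k ∈ Finset.range (j + 1), ∑ i ∈ Finset.range (N + 1 - k),
        Polynomial.C ((-1) ^ k *
          (Real.Gamma (((j - k : ℕ) : ℝ) + (μ + 1) / 2) * ((2 * N + 1 - i - 1).factorial : ℝ)) /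
          ((k.factorial : ℝ) * Real.Gamma (((j - k : ℕ) : ℝ) + μ + 1) *
            ((N - i - k).factorial : ℝ) * (i.factorial : ℝ))) *
        laguerrePoly (j - k) μ * Polynomial.X ^ i, ?_, fun x => ?_⟩
    · rw [Polynomial.natDegree_C_mul (div_ne_zero hm hl),
        natDegree_sum_laguerrePoly hα (fun k i => (-1) ^ k *
          (Real.Gamma (((j - k : ℕ) : ℝ) + (μ + 1) / 2) * ((2 * N + 1 - i - 1).factorial : ℝ)) /
          ((k.factorial : ℝ) * Real.Gamma (((j - k : ℕ) : ℝ) + μ + 1) *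
            ((N - i - k).factorial : ℝ) * (i.factorial : ℝ)))]
      simp [hl, hm, Nat.factorial_ne_zero]
    · simp only [polyM, hN, Polynomial.eval_mul, Polynomial.eval_C, Polynomial.eval_finsetSum,
        Polynomial.eval_pow, Polynomial.eval_X, eval_laguerrePoly]
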